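/- Let X be a compact Ptolemy space with properties (E) and (sI), not Möbius equivalent to the extended real line. Then for any two distinct points ω, ω' ∈ X there exist two distinct Ptolemy lines ℓ, ℓ' in X_ω = X \ {ω} whose intersection is exactly {ω'}. -/

import Mathlib

/-- Projective equality of triples of reals, i.e. equality in `ℝP²`. -/
def ProjEq (a b : ℝ × ℝ × ℝ) : Prop :=
  ∃ c : ℝ, 0 < c ∧ b.1 = c * a.1 ∧ b.2.1 = c * a.2.1 ∧ b.2.2 = c * a.2.2

/-- A quadruple is admissible if no entry occurs three or four times. -/
def Admissible {X : Type*} (x y z u : X) : Prop :=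
  ¬ ((x = y ∧ y = z) ∨ (x = y ∧ y = u) ∨ (x = z ∧ z = u) ∨ (y = z ∧ z = u))

open scoped Classical in
/-- The cross-ratio triple of a quadruple with respect to an extended metric `d` with
infinitely remote point `ω`, with the standard conventions when `ω` occurs among the
entries: e.g. `crt(x,y,z,ω) = (d(x,y) : d(x,z) : d(y,z))` and `crt(x,y,ω,ω) = (0:1:1)`. -/
noncomputable def crt {X : Type*} (d : X → X → ℝ) (ω x y z u : X) : ℝ × ℝ × ℝ :=
  if x = ω then
    (if y = ω then ((0 : ℝ), 1, 1) else if z = ω then ((1 : ℝ), 0, 1)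
      else if u = ω then ((1 : ℝ), 1, 0) else (d z u, d y u, d y z))
  else if y = ω then
    (if z = ω then ((1 : ℝ), 1, 0) else if u = ω then ((1 : ℝ), 0, 1)
      else (d z u, d x z, d x u))
  else if z = ω then
    (if u = ω then ((0 : ℝ), 1, 1) else (d x y, d y u, d x u))
  else if u = ω then (d x y, d x z, d y z)
  else (d x y * d z u, d x z * d y u, d x u * d y z)


/-- A Möbius structure on a compact space `X`: for every point `ω` a metric
`dist ω : X → X → ℝ` on `X \ {ω}` having `ω` as infinitely remote point, all metrics
pairwise Möbius equivalent, each satisfying the Ptolemy inequality, and compatible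
with the topology of `X`. -/
structure MoebiusStructure (X : Type*) [TopologicalSpace X] where
  dist : X → X → X → ℝ
  dist_self : ∀ ω x, dist ω x x = 0
  dist_comm : ∀ ω x y, dist ω x y = dist ω y x
  dist_pos : ∀ ω x y, x ≠ ω → y ≠ ω → x ≠ y → 0 < dist ω x y
  dist_triangle : ∀ ω x y z, x ≠ ω → y ≠ ω → z ≠ ω →
    dist ω x z ≤ dist ω x y + dist ω y z
  ptolemy : ∀ ω x y z u, x ≠ ω → y ≠ ω → z ≠ ω → u ≠ ω →
    dist ω x z * dist ω y u ≤ dist ω x y * dist ω z u + dist ω x u * dist ω y z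
  moebius_equivalent : ∀ ω ω' x y z u, Admissible x y z u →
    ProjEq (crt (dist ω) ω x y z u) (crt (dist ω') ω' x y z u)
  isOpen_ball : ∀ ω x r, x ≠ ω → IsOpen {y | y ≠ ω ∧ dist ω x y < r}
  isOpen_compl_closedBall : ∀ ω x r, x ≠ ω →
    IsOpen ({y | y ≠ ω ∧ r < dist ω x y} ∪ {ω})
  nhds_basis : ∀ ω x, x ≠ ω → ∀ U ∈ nhds x, ∃ r > 0, {y | y ≠ ω ∧ dist ω x y < r} ⊆ U

namespace MoebiusStructure

variable {X : Type*} [TopologicalSpace X] (S : MoebiusStructure X)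

/-- A Möbius map of `(X, S)`: preserves all cross-ratio triples. -/
def IsMoebiusMap (φ : X → X) : Prop :=
  ∀ ω x y z u, Admissible x y z u →
    ProjEq (crt (S.dist ω) ω x y z u) (crt (S.dist ω) ω (φ x) (φ y) (φ z) (φ u))

/-- `(x,z)` separates `(y,u)` on `σ`: `y` and `u` lie in different connected components
of `σ \ {x,z}`. -/
def Separates (σ : Set X) (x z y u : X) : Prop :=
  ∀ C : Set X, IsPreconnected C → C ⊆ σ \ {x, z} → ¬(y ∈ C ∧ u ∈ C)

/-- A Ptolemy circle: a subset homeomorphic to `S¹` on which the Ptolemy equality holds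
for every quadruple of distinct points with separated diagonal. -/
def IsPtolemyCircle (σ : Set X) : Prop :=
  Nonempty (σ ≃ₜ Metric.sphere (0 : ℂ) 1) ∧
    ∀ ω, ∀ x ∈ σ, ∀ y ∈ σ, ∀ z ∈ σ, ∀ u ∈ σ,
      x ≠ ω → y ≠ ω → z ≠ ω → u ≠ ω →
      x ≠ y → x ≠ z → x ≠ u → y ≠ z → y ≠ u → z ≠ u →
      Separates σ x z y u →
      S.dist ω x z * S.dist ω y u =
        S.dist ω x y * S.dist ω z u + S.dist ω x u * S.dist ω y z

/-- A Ptolemy line in `X_ω`: a Ptolemy circle through `ω` with `ω` removed. -/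
def IsPtolemyLine (ω : X) (ℓ : Set X) : Prop :=
  ∃ σ : Set X, S.IsPtolemyCircle σ ∧ ω ∈ σ ∧ ℓ = σ \ {ω}

/-- A metric sphere between `ω` and `ω'`: a sphere of positive radius centered at `ω`
for the metric with infinitely remote point `ω'`. -/
def IsSphereBetween (ω ω' : X) (Sp : Set X) : Prop :=
  ∃ r : ℝ, 0 < r ∧ Sp = {x | x ≠ ω' ∧ S.dist ω' ω x = r}

/-- A strong space inversion w.r.t. `ω`, `ω'` and a metric sphere `Sp` between them:
a Möbius involution swapping `ω` and `ω'`, fixing `Sp` pointwise, and preserving every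
Ptolemy circle through `ω` and `ω'`. -/
def IsStrongInversion (ω ω' : X) (Sp : Set X) (φ : X → X) : Prop :=
  S.IsMoebiusMap φ ∧ Function.Bijective φ ∧ φ ∘ φ = id ∧
    φ ω = ω' ∧ φ ω' = ω ∧ (∀ x ∈ Sp, φ x = x) ∧
    ∀ σ : Set X, S.IsPtolemyCircle σ → ω ∈ σ → ω' ∈ σ → φ '' σ = σ

/-- Property (E): existence of a Ptolemy circle. -/
def PropE : Prop := ∃ σ : Set X, S.IsPtolemyCircle σ

/-- Property (sI): existence of strong space inversions for every pair of distinct points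
and every metric sphere between them. -/
def PropSI : Prop :=
  ∀ ω ω' : X, ω ≠ ω' → ∀ Sp : Set X, S.IsSphereBetween ω ω' Sp →
    ∃ φ : X → X, S.IsStrongInversion ω ω' Sp φ

end MoebiusStructure

/-- The standard Möbius family of metrics on the extended real line `ℝ̂ = ℝ ∪ {∞}`
(modelled as `Option ℝ`, with `none` the point `∞`): `stdDist ω` is the metric with
infinitely remote point `ω`; for `ω = ∞` it is the Euclidean metric and for `ω = a ∈ ℝ`
it is the metric inversion of the Euclidean metric at `a`. -/
noncomputable def stdDist : Option ℝ → Option ℝ → Option ℝ → ℝ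
  | none, some x, some y => |x - y|
  | some a, some x, some y =>
      if x = a ∨ y = a then 0 else |x - y| / (|x - a| * |y - a|)
  | some a, some x, none => if x = a then 0 else 1 / |x - a|
  | some a, none, some y => if y = a then 0 else 1 / |y - a|
  | _, _, _ => 0

/-- `X` is Möbius equivalent to the extended real line. -/
def MoebiusEquivToExtendedRealLine {X : Type*} [TopologicalSpace X]
    (S : MoebiusStructure X) : Prop :=
  ∃ f : X ≃ Option ℝ, ∀ ω x y z u : X, Admissible x y z u →
    ProjEq (crt (S.dist ω) ω x y z u)
      (crt (stdDist (f ω)) (f ω) (f x) (f y) (f z) (f u))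


/-! ### Auxiliary lemmas -/

/-- Weight used to compare the standard metrics. -/
noncomputable def stdWeight (a : ℝ) : Option ℝ → ℝ
  | none => 1
  | some b => if b = a then 1 else 1 / |b - a|

theorem stdWeight_pos (a : ℝ) (x : Option ℝ) : 0 < stdWeight a x := by
  rcases x with _ | b
  · simp [stdWeight]
  · by_cases h : b = a
    · simp [stdWeight, h]
    · have : 0 < |b - a| := abs_pos.mpr (sub_ne_zero.mpr h)
      simp only [stdWeight, h, if_false]; positivity

set_option maxHeartbeats 4000000 in
theorem std_change (a : ℝ) (x y z u : Option ℝ) (h : Admissible x y z u) :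
    ProjEq (crt (stdDist none) none x y z u) (crt (stdDist (some a)) (some a) x y z u) := by
  refine ⟨stdWeight a x * stdWeight a y * stdWeight a z * stdWeight a u, ?_, ?_⟩
  · have := stdWeight_pos a x
    have := stdWeight_pos a y
    have := stdWeight_pos a z
    have := stdWeight_pos a u
    positivity
  have key : ∀ v : Option ℝ, v = none ∨ v = some a ∨ ∃ b, b ≠ a ∧ v = some b ∧ |b - a| ≠ 0 := by
    intro v
    rcases v with _ | b
    · simp
    · by_cases h : b = a
      · simp [h]
      · exact Or.inr (Or.inr ⟨b, h, rfl, abs_ne_zero.mpr (sub_ne_zero.mpr h)⟩)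
  unfold Admissible at h
  rcases key x with rfl | rfl | ⟨x, hx, rfl, hx'⟩ <;>
  rcases key y with rfl | rfl | ⟨y, hy, rfl, hy'⟩ <;>
  rcases key z with rfl | rfl | ⟨z, hz, rfl, hz'⟩ <;>
  rcases key u with rfl | rfl | ⟨u, hu, rfl, hu'⟩ <;>
  first
  | (exfalso; simp at h; done)
  | (simp_all [crt, stdDist, stdWeight, abs_sub_comm a]; done)
  | (simp_all [crt, stdDist, stdWeight, abs_sub_comm a]
     try refine ⟨?_, ?_, ?_⟩
     all_goals try refine ⟨?_, ?_⟩
     all_goals field_simp)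

theorem ProjEq.trans' {a b c : ℝ × ℝ × ℝ} (h : ProjEq a b) (h' : ProjEq b c) : ProjEq a c := by
  obtain ⟨k, hk, h1, h2, h3⟩ := h
  obtain ⟨l, hl, g1, g2, g3⟩ := h'
  refine ⟨l * k, by positivity, ?_, ?_, ?_⟩
  · rw [g1, h1]; ring
  · rw [g2, h2]; ring
  · rw [g3, h3]; ring

theorem Admissible.map {X Y : Type*} {x y z u : X} (h : Admissible x y z u) {f : X → Y}
    (hf : Function.Injective f) : Admissible (f x) (f y) (f z) (f u) := by
  unfold Admissible at *
  simpa only [hf.eq_iff] using h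

/-- A unit speed parametrization of the Ptolemy line `σ \ {ω}`. -/
def IsParam {X : Type*} [TopologicalSpace X] (S : MoebiusStructure X) (ω : X) (σ : Set X)
    (c : ℝ → X) : Prop :=
  Set.range c = σ \ {ω} ∧ ∀ s t, S.dist ω (c s) (c t) = |s - t|

section
variable {X : Type*} [TopologicalSpace X] {S : MoebiusStructure X}

theorem IsParam.inj {ω : X} {σ : Set X} {c : ℝ → X} (h : IsParam S ω σ c) :
    Function.Injective c := by
  intro s t hst
  have := h.2 s t
  rw [hst, S.dist_self] at this
  exact sub_eq_zero.mp (abs_eq_zero.mp this.symm)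

theorem IsParam.mem {ω : X} {σ : Set X} {c : ℝ → X} (h : IsParam S ω σ c) (t : ℝ) :
    c t ∈ σ ∧ c t ≠ ω := by
  have : c t ∈ σ \ {ω} := h.1 ▸ Set.mem_range_self t
  simpa using this

theorem IsParam.exists {ω : X} {σ : Set X} {c : ℝ → X} (h : IsParam S ω σ c) {p : X}
    (hp : p ∈ σ) (hpω : p ≠ ω) : ∃ t, c t = p := by
  have : p ∈ Set.range c := h.1 ▸ (by simp [hp, hpω])
  exact this

theorem IsParam.shift {ω : X} {σ : Set X} {c : ℝ → X} (h : IsParam S ω σ c) (a : ℝ) :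
    IsParam S ω σ (fun t => c (a + t)) := by
  refine ⟨?_, fun s t => by simp [h.2]⟩
  rw [← h.1]
  exact (Equiv.addLeft a).surjective.range_comp c

theorem IsParam.flip {ω : X} {σ : Set X} {c : ℝ → X} (h : IsParam S ω σ c) (a : ℝ) :
    IsParam S ω σ (fun t => c (a - t)) := by
  refine ⟨?_, fun s t => by simp only [h.2]; rw [abs_sub_comm]; congr 1; ring⟩
  rw [← h.1]
  exact (Equiv.subLeft a).surjective.range_comp c

theorem equiv_of_univ {ω : X} {σ : Set X} {c : ℝ → X} (h : IsParam S ω σ c)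
    (hσ : σ = Set.univ) : MoebiusEquivToExtendedRealLine S := by
  let g : Option ℝ → X := fun v => v.elim ω c
  have g0 : g none = ω := rfl
  have g1 : ∀ t, g (some t) = c t := fun _ => rfl
  have hω : ∀ t, c t ≠ ω := fun t => (h.mem t).2
  have hinj : Function.Injective g := by
    intro a b hab
    rcases a with _ | a <;> rcases b with _ | b
    · rfl
    · exact absurd hab.symm (hω b)
    · exact absurd hab (hω a)
    · exact congrArg some (h.inj hab)
  have hsurj : Function.Surjective g := by
    intro x
    by_cases hx : x = ω
    · exact ⟨none, hx.symm⟩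
    · obtain ⟨t, ht⟩ := h.exists (p := x) (by simp [hσ]) hx
      exact ⟨some t, ht⟩
  let e : Option ℝ ≃ X := Equiv.ofBijective g ⟨hinj, hsurj⟩
  refine ⟨e.symm, fun ω₁ x y z u hadm => ?_⟩
  have hadm' := hadm.map e.symm.injective
  have h1 := S.moebius_equivalent ω₁ ω x y z u hadm
  have key : ∀ x y z u : Option ℝ, crt (S.dist ω) ω (g x) (g y) (g z) (g u)
      = crt (stdDist none) none x y z u := by
    intro x y z u
    rcases x with _ | x <;> rcases y with _ | y <;> rcases z with _ | z <;>
      rcases u with _ | u <;> simp [crt, stdDist, g0, g1, hω, h.2]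
  have hk := key (e.symm x) (e.symm y) (e.symm z) (e.symm u)
  have hg : ∀ x, g (e.symm x) = x := fun x => e.apply_symm_apply x
  simp only [hg] at hk
  rw [hk] at h1
  rcases hh : e.symm ω₁ with _ | a
  · exact h1
  · exact h1.trans' (std_change a _ _ _ _ hadm')

/-- The triangle form of the Möbius property. -/
theorem tri_moebius {φ : X → X} (hφ : S.IsMoebiusMap φ) (hi : Function.Injective φ)
    {a x y z : X} (hx : x ≠ a) (hy : y ≠ a) (hz : z ≠ a) (hne : x ≠ y) :
    ∃ k : ℝ, 0 < k ∧ S.dist (φ a) (φ x) (φ y) = k * S.dist a x y ∧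
      S.dist (φ a) (φ x) (φ z) = k * S.dist a x z ∧
      S.dist (φ a) (φ y) (φ z) = k * S.dist a y z := by
  have hadm : Admissible x y z a := by
    unfold Admissible; tauto
  have h1 := (hφ a x y z a hadm).trans'
    (S.moebius_equivalent a (φ a) _ _ _ _ (hadm.map hi))
  obtain ⟨k, hk, h⟩ := h1
  refine ⟨k, hk, ?_⟩
  simpa [crt, hx, hy, hz, hi.eq_iff] using h

theorem homothety {φ : X → X} (hφ : S.IsMoebiusMap φ) (hi : Function.Injective φ) (a : X) :
    ∃ k : ℝ, 0 < k ∧ ∀ x y, x ≠ a → y ≠ a →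
      S.dist (φ a) (φ x) (φ y) = k * S.dist a x y := by
  by_cases hex : ∃ p q, p ≠ a ∧ q ≠ a ∧ p ≠ q
  · obtain ⟨p, q, hp, hq, hpq⟩ := hex
    obtain ⟨k, hk, hk1, -⟩ := tri_moebius hφ hi hp hq hp hpq
    refine ⟨k, hk, ?_⟩
    have hp1 : ∀ x, x ≠ a → S.dist (φ a) (φ p) (φ x) = k * S.dist a p x := by
      intro x hx
      obtain ⟨l, hl, h1, h2, -⟩ := tri_moebius hφ hi hp hq hx hpq
      have hd := S.dist_pos a p q hp hq hpq
      have : l = k := by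
        have : l * S.dist a p q = k * S.dist a p q := by rw [← h1, ← hk1]
        exact mul_right_cancel₀ hd.ne' this
      rw [h2, this]
    intro x y hx hy
    by_cases hxp : p = x
    · subst hxp; exact hp1 y hy
    · obtain ⟨l, hl, h1, -, h2⟩ := tri_moebius hφ hi hp hx hy hxp
      have hd := S.dist_pos a p x hp hx hxp
      have : l = k := by
        have : l * S.dist a p x = k * S.dist a p x := by rw [← h1, hp1 x hx]
        exact mul_right_cancel₀ hd.ne' this
      rw [h2, this]
  · refine ⟨1, one_pos, fun x y hx hy => ?_⟩
    have : x = y := by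
      by_contra hne
      exact hex ⟨x, y, hx, hy, hne⟩
    subst this
    simp [S.dist_self]

theorem moebius_continuous {φ : X → X} (hφ : S.IsMoebiusMap φ) (hi : Function.Injective φ) :
    Continuous φ := by
  rw [continuous_iff_continuousAt]
  intro x
  by_cases hex : ∃ a, a ≠ x
  · obtain ⟨a, ha⟩ := hex
    obtain ⟨k, hk, h⟩ := homothety hφ hi a
    intro U hU
    obtain ⟨r, hr, hrU⟩ := S.nhds_basis (φ a) (φ x) (hi.ne ha.symm) U hU
    have hop := S.isOpen_ball a x (r / k) ha.symm
    have hmem : {y | y ≠ a ∧ S.dist a x y < r / k} ∈ nhds x :=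
      hop.mem_nhds ⟨ha.symm, by rw [S.dist_self]; positivity⟩
    refine Filter.mem_map.mpr (Filter.mem_of_superset hmem ?_)
    rintro y ⟨hy, hd⟩
    refine hrU ⟨hi.ne hy, ?_⟩
    rw [h x y ha.symm hy]
    rw [lt_div_iff₀ hk] at hd
    linarith
  · push Not at hex
    have : φ = fun _ => φ x := by
      funext y; rw [hex y]
    rw [this]
    exact continuousAt_const

theorem circle_image {φ : X → X} (hφ : S.IsMoebiusMap φ) (hinv : φ ∘ φ = id) {σ : Set X}
    (hσ : S.IsPtolemyCircle σ) : S.IsPtolemyCircle (φ '' σ) := by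
  have hφφ : Function.Involutive φ := fun x => congrFun hinv x
  have hi := hφφ.injective
  have hc := moebius_continuous hφ hi
  let e : X ≃ₜ X := ⟨hφφ.toPerm, hc, hc⟩
  obtain ⟨⟨h⟩, hP⟩ := hσ
  refine ⟨⟨(e.image σ).symm.trans h⟩, ?_⟩
  intro ω x hx y hy z hz u hu hxω hyω hzω huω hxy hxz hxu hyz hyu hzu hsep
  obtain ⟨x, hx, rfl⟩ := hx
  obtain ⟨y, hy, rfl⟩ := hy
  obtain ⟨z, hz, rfl⟩ := hz
  obtain ⟨u, hu, rfl⟩ := hu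
  obtain ⟨w, rfl⟩ := hφφ.surjective ω
  rw [hi.ne_iff] at *
  obtain ⟨k, hk, hh⟩ := homothety hφ hi w
  have := hP w x hx y hy z hz u hu hxω hyω hzω huω hxy hxz hxu hyz hyu hzu (by
    intro C hC hCs hyu
    refine hsep (φ '' C) (hC.image φ hc.continuousOn) ?_
      ⟨Set.mem_image_of_mem φ hyu.1, Set.mem_image_of_mem φ hyu.2⟩
    rintro _ ⟨v, hv, rfl⟩
    have := hCs hv
    simp only [Set.mem_sdiff, Set.mem_insert_iff, Set.mem_singleton_iff, hi.eq_iff] at this ⊢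
    exact ⟨Set.mem_image_of_mem φ this.1, this.2⟩)
  rw [hh x z hxω hzω, hh y u hyω huω, hh x y hxω hyω, hh z u hzω huω, hh x u hxω huω,
    hh y z hyω hzω]
  linear_combination k ^ 2 * this

/-- Inversions act on lines through the centre in the expected way. -/
theorem inversion_line {ω o : X} {φ : X → X} {r : ℝ} (hr : 0 < r)
    (hφ : S.IsStrongInversion o ω {x | x ≠ ω ∧ S.dist ω o x = r} φ)
    {σ : Set X} (hσ : S.IsPtolemyCircle σ) (hω : ω ∈ σ) {c : ℝ → X} (hc : IsParam S ω σ c)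
    (h0 : c 0 = o) {s : ℝ} (hs : 0 < s) : φ (c s) = c (r ^ 2 / s) := by
  obtain ⟨hM, hbij, -, hφo, hφω, hfix, hinv⟩ := hφ
  have hoω : o ≠ ω := h0 ▸ (hc.mem 0).2
  have hoσ : o ∈ σ := h0 ▸ (hc.mem 0).1
  have hcs : c s ≠ o := by rw [← h0]; exact hc.inj.ne hs.ne'
  have hcr : φ (c r) = c r := hfix _ ⟨(hc.mem r).2, by
    rw [← h0, hc.2]; simp [abs_of_pos hr]⟩
  have hmem : φ (c s) ∈ σ := by
    rw [← hinv σ hσ hoσ hω]; exact Set.mem_image_of_mem φ (hc.mem s).1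
  have hne : φ (c s) ≠ ω := by
    rw [← hφo]; exact hbij.1.ne hcs
  obtain ⟨v, hv⟩ := hc.exists hmem hne
  have hadm : Admissible (c s) (c r) o ω := by
    have h1 := (hc.mem s).2
    have h2 := (hc.mem r).2
    unfold Admissible
    rintro (h | h | h | h)
    · exact hcs (h.1.trans h.2)
    · exact h2 h.2
    · exact hoω h.2
    · exact hoω h.2
  obtain ⟨k, hk, e1, e2, e3⟩ := hM ω _ _ _ _ hadm
  rw [hφo, hφω, hcr, ← hv] at e1 e2 e3
  simp only [crt, (hc.mem s).2, (hc.mem r).2, (hc.mem v).2, hoω, if_false, if_true] at e1 e2 e3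
  rw [← h0] at e2 e3
  rw [hc.2, hc.2] at e1 e2 e3
  simp only [sub_zero, abs_of_pos hr, abs_of_pos hs] at e2 e3
  have hks : k = r / s := by field_simp; linarith
  have hvk : |v| = r ^ 2 / s := by rw [e3, hks]; ring
  rw [← hv]
  congr 1
  rcases abs_choice v with h | h
  · rw [← h, hvk]
  · exfalso
    have hpos : 0 < r ^ 2 / s := by positivity
    have hvneg : v < 0 := by linarith
    rw [abs_of_neg (by linarith)] at e1
    have h5 : r + k * r = k * |s - r| := by rw [← e1, ← e3, h]; ring
    have h6 : |s - r| < s + r := abs_lt.mpr ⟨by linarith, by linarith⟩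
    have h7 : k * |s - r| < k * (s + r) := by gcongr
    nlinarith

theorem param_eq_pos (hSI : S.PropSI) {ω : X} {σ σ' : Set X} (hσ : S.IsPtolemyCircle σ)
    (hσ' : S.IsPtolemyCircle σ') (hω : ω ∈ σ) (hω' : ω ∈ σ') {c c' : ℝ → X}
    (hc : IsParam S ω σ c) (hc' : IsParam S ω σ' c') (h0 : c 0 = c' 0) {s : ℝ} (hs : 0 < s)
    (hcs : c s = c' s) {t : ℝ} (ht : 0 < t) : c t = c' t := by
  have hr : 0 < Real.sqrt (s * t) := Real.sqrt_pos.mpr (by positivity)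
  obtain ⟨φ, hφ⟩ := hSI (c 0) ω (hc.mem 0).2 _ ⟨_, hr, rfl⟩
  have h1 := inversion_line hr hφ hσ hω hc rfl hs
  have h2 := inversion_line hr hφ hσ' hω' hc' h0.symm hs
  rw [hcs, h2, Real.sq_sqrt (by positivity)] at h1
  have : s * t / s = t := by field_simp
  rw [this] at h1
  exact h1.symm

theorem param_eq (hSI : S.PropSI) {ω : X} {σ σ' : Set X} (hσ : S.IsPtolemyCircle σ)
    (hσ' : S.IsPtolemyCircle σ') (hω : ω ∈ σ) (hω' : ω ∈ σ') {c c' : ℝ → X}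
    (hc : IsParam S ω σ c) (hc' : IsParam S ω σ' c') (h0 : c 0 = c' 0) {s : ℝ} (hs : 0 < s)
    (hcs : c s = c' s) : σ \ {ω} = σ' \ {ω} := by
  have h : c = c' := by
    funext t
    rcases lt_or_ge 0 t with ht | ht
    · exact param_eq_pos hSI hσ hσ' hω hω' hc hc' h0 hs hcs ht
    · have := param_eq_pos hSI hσ hσ' hω hω' (hc.flip s) (hc'.flip s) (by simpa using hcs) hs
        (by simpa using h0) (t := s - t) (by linarith)
      simpa using this
  rw [← hc.1, ← hc'.1, h]

/-- Cayley parametrization of the unit circle minus a point. -/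
noncomputable def cay (t : ℝ) : ℂ := ⟨(t ^ 2 - 1) / (t ^ 2 + 1), 2 * t / (t ^ 2 + 1)⟩

theorem cay_norm (t : ℝ) : ‖cay t‖ = 1 := by
  rw [← sq_eq_sq₀ (norm_nonneg _) zero_le_one, Complex.sq_norm, Complex.normSq_apply]
  simp only [cay]
  field_simp
  ring

theorem cay_continuous : Continuous cay := by
  have h : cay = fun t : ℝ => (((t ^ 2 - 1) / (t ^ 2 + 1) : ℝ) : ℂ)
      + ((2 * t / (t ^ 2 + 1) : ℝ) : ℂ) * Complex.I := by
    funext t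
    exact Complex.mk_eq_add_mul_I _ _
  rw [h]
  have h1 : Continuous fun t : ℝ => (t ^ 2 - 1) / (t ^ 2 + 1) :=
    Continuous.div (by fun_prop) (by fun_prop) (fun t => by positivity)
  have h2 : Continuous fun t : ℝ => 2 * t / (t ^ 2 + 1) :=
    Continuous.div (by fun_prop) (by fun_prop) (fun t => by positivity)
  fun_prop

theorem cay_ne_one (t : ℝ) : cay t ≠ 1 := by
  intro h
  have h1 : (t ^ 2 - 1) / (t ^ 2 + 1) = 1 := by simpa [cay] using congrArg Complex.re h
  field_simp at h1
  linarith

theorem cay_surj {w : ℂ} (hw : ‖w‖ = 1) (h1 : w ≠ 1) : ∃ t, cay t = w := by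
  have hn : w.re * w.re + w.im * w.im = 1 := by
    rw [← Complex.normSq_apply, ← Complex.sq_norm, hw, one_pow]
  have hre : 1 - w.re ≠ 0 := by
    intro h
    have hr : w.re = 1 := by linarith
    have him : w.im = 0 := by
      rw [hr] at hn; nlinarith
    exact h1 (Complex.ext (by simpa using hr) (by simpa using him))
  have hsq : (w.im / (1 - w.re)) ^ 2 + 1 = 2 / (1 - w.re) := by
    field_simp
    linarith
  refine ⟨w.im / (1 - w.re), Complex.ext ?_ ?_⟩
  · have : (w.im / (1 - w.re)) ^ 2 - 1 = 2 / (1 - w.re) - 2 := by linarith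
    simp only [cay]
    rw [this, hsq]
    field_simp
    ring
  · simp only [cay]
    rw [hsq]
    field_simp

/-- A real-linear function whose zeros on the circle are `cay s` and `cay u`. -/
noncomputable def chord (s u : ℝ) (w : ℂ) : ℝ :=
  (1 + w.re) / 2 - (s + u) * w.im / 2 + s * u * (1 - w.re) / 2

theorem chord_cay (s u t : ℝ) : chord s u (cay t) = (t - s) * (t - u) / (t ^ 2 + 1) := by
  simp only [chord, cay]
  field_simp
  ring

theorem chord_continuous (s u : ℝ) : Continuous (chord s u) := by
  unfold chord
  fun_prop

theorem cay_inj : Function.Injective cay := by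
  intro s t h
  have h1 := chord_cay s s t
  rw [← h, chord_cay] at h1
  have h2 : (t - s) * (t - s) / (t ^ 2 + 1) = 0 := by rw [← h1]; simp
  have h3 : (t ^ 2 + 1 : ℝ) ≠ 0 := by positivity
  rw [div_eq_zero_iff] at h2
  have : t - s = 0 := by
    rcases h2 with h2 | h2
    · simpa using h2
    · exact absurd h2 h3
  linarith

theorem cay_tendsto {l : Filter ℝ} (hl : Filter.Tendsto (fun t : ℝ => t ^ 2) l Filter.atTop) :
    Filter.Tendsto cay l (nhds 1) := by
  rw [tendsto_iff_norm_sub_tendsto_zero]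
  have h1 : Filter.Tendsto (fun t : ℝ => Real.sqrt (4 * (t ^ 2 + 1)⁻¹)) l (nhds 0) := by
    have h2 : Filter.Tendsto (fun t : ℝ => (t ^ 2 + 1)⁻¹) l (nhds 0) :=
      (Filter.tendsto_atTop_add_const_right l 1 hl).inv_tendsto_atTop
    have h3 := (h2.const_mul 4).sqrt
    simpa using h3
  refine h1.congr (fun t => ?_)
  rw [Complex.norm_def, Complex.normSq_apply]
  congr 1
  simp [cay]
  field_simp
  ring

/-- A topological parametrization of a punctured Ptolemy circle with additive distances. -/
theorem exists_gamma {ω : X} {σ : Set X} (hσ : S.IsPtolemyCircle σ) (hω : ω ∈ σ) :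
    ∃ γ : ℝ → X, Continuous γ ∧ Function.Injective γ ∧ Set.range γ = σ \ {ω} ∧
      Filter.Tendsto γ Filter.atTop (nhds ω) ∧ Filter.Tendsto γ Filter.atBot (nhds ω) ∧
      ∀ s t u, s < t → t < u →
        S.dist ω (γ s) (γ u) = S.dist ω (γ s) (γ t) + S.dist ω (γ t) (γ u) := by
  obtain ⟨⟨h⟩, hP⟩ := hσ
  let w₀ : ℂ := (h ⟨ω, hω⟩ : ℂ)
  have hw₀ : ‖w₀‖ = 1 := mem_sphere_zero_iff_norm.mp (h ⟨ω, hω⟩).2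
  have hw0 : w₀ ≠ 0 := by
    intro h0; rw [h0] at hw₀; simp at hw₀
  let e : ℝ → Metric.sphere (0 : ℂ) 1 := fun t => ⟨w₀ * cay t, by simp [hw₀, cay_norm]⟩
  have he : Continuous e := Continuous.subtype_mk (continuous_const.mul cay_continuous) _
  have hei : Function.Injective e := by
    intro s t hst
    have h1 : w₀ * cay s = w₀ * cay t := congrArg Subtype.val hst
    exact cay_inj (mul_left_cancel₀ hw0 h1)
  let γ : ℝ → X := fun t => (h.symm (e t) : X)
  have hγσ : ∀ t, γ t ∈ σ := fun t => (h.symm (e t)).2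
  have hγh : ∀ t (ht : γ t ∈ σ), h ⟨γ t, ht⟩ = e t := fun t _ => h.apply_symm_apply (e t)
  have hγω : ∀ t, γ t ≠ ω := by
    intro t ht
    have h1 : h.symm (e t) = ⟨ω, hω⟩ := Subtype.ext ht
    have h2 : e t = h ⟨ω, hω⟩ := by rw [← h1, h.apply_symm_apply]
    have h3 : w₀ * cay t = w₀ := congrArg Subtype.val h2
    exact cay_ne_one t (mul_left_cancel₀ hw0 (by rw [h3, mul_one]))
  have hγi : Function.Injective γ := fun s t hst =>
    hei (h.symm.injective (Subtype.ext hst))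
  have hlim : ∀ l : Filter ℝ, Filter.Tendsto (fun t : ℝ => t ^ 2) l Filter.atTop →
      Filter.Tendsto γ l (nhds ω) := by
    intro l hl
    have h1 : Filter.Tendsto e l (nhds (h ⟨ω, hω⟩)) := by
      rw [tendsto_subtype_rng]
      have := (cay_tendsto hl).const_mul w₀
      rw [mul_one] at this
      exact this
    have h2 := ((h.symm.continuous.tendsto _).comp h1)
    rw [h.symm_apply_apply] at h2
    exact (continuous_subtype_val.tendsto _).comp h2
  refine ⟨γ, continuous_subtype_val.comp (h.symm.continuous.comp he), hγi, ?_, ?_, ?_, ?_⟩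
  · ext x
    constructor
    · rintro ⟨t, rfl⟩
      exact ⟨hγσ t, hγω t⟩
    · rintro ⟨hx, hxω⟩
      have hn : ‖((h ⟨x, hx⟩ : Metric.sphere (0 : ℂ) 1) : ℂ)‖ = 1 := by
        simp
      obtain ⟨t, ht⟩ := cay_surj (w := (h ⟨x, hx⟩ : ℂ) / w₀) (by rw [norm_div, hn, hw₀, div_one])
        (by
          intro h1
          rw [div_eq_one_iff_eq hw0] at h1
          have h2 : h ⟨x, hx⟩ = h ⟨ω, hω⟩ := Subtype.ext h1
          exact hxω (congrArg Subtype.val (h.injective h2)))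
      refine ⟨t, ?_⟩
      have h1 : e t = h ⟨x, hx⟩ := Subtype.ext (by
        show w₀ * cay t = _
        rw [ht]; field_simp)
      show ((h.symm (e t) : σ) : X) = x
      rw [h1, h.symm_apply_apply]
  · exact hlim _ (Filter.tendsto_pow_atTop two_ne_zero)
  · refine hlim _ ?_
    have := (Filter.tendsto_pow_atTop (α := ℝ) two_ne_zero).comp Filter.tendsto_neg_atBot_atTop
    refine this.congr (fun t => by simp)
  · intro s t u hst htu
    -- choose an auxiliary base point
    have hb : ∃ b, b = γ (u + 1) := ⟨_, rfl⟩
    obtain ⟨b, hb⟩ := hb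
    have hsb : γ s ≠ b := by rw [hb]; exact hγi.ne (by linarith)
    have htb : γ t ≠ b := by rw [hb]; exact hγi.ne (by linarith)
    have hub : γ u ≠ b := by rw [hb]; exact hγi.ne (by linarith)
    have hωb : ω ≠ b := by rw [hb]; exact (hγω _).symm
    have hst' : γ s ≠ γ t := hγi.ne (by linarith)
    have hsu' : γ s ≠ γ u := hγi.ne (by linarith)
    have htu' : γ t ≠ γ u := hγi.ne (by linarith)
    have hsep : MoebiusStructure.Separates σ (γ s) (γ u) (γ t) ω := by
      rintro C hC hCσ ⟨htC, hωC⟩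
      let f : σ → ℝ := fun x => chord s u (((h x : Metric.sphere (0 : ℂ) 1) : ℂ) / w₀)
      have hf : Continuous f := (chord_continuous s u).comp
        ((continuous_subtype_val.comp h.continuous).div_const w₀)
      have hfγ : ∀ v (hv : γ v ∈ σ), f ⟨γ v, hv⟩ = (v - s) * (v - u) / (v ^ 2 + 1) := by
        intro v hv
        have : ((h ⟨γ v, hv⟩ : Metric.sphere (0 : ℂ) 1) : ℂ) / w₀ = cay v := by
          rw [hγh]
          show w₀ * cay v / w₀ = cay v
          field_simp
        simp only [f]
        rw [this, chord_cay]
      have hfω : f ⟨ω, hω⟩ = 1 := by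
        have : ((h ⟨ω, hω⟩ : Metric.sphere (0 : ℂ) 1) : ℂ) / w₀ = 1 := div_self hw0
        simp only [f]
        rw [this]
        simp [chord]
      have hC' : IsPreconnected (Subtype.val ⁻¹' C : Set σ) := by
        rw [Topology.IsInducing.subtypeVal.isPreconnected_image.symm]
        rw [Subtype.image_preimage_coe, Set.inter_eq_self_of_subset_right
          (fun x hx => (hCσ hx).1)]
        exact hC
      have hiv := hC'.intermediate_value (a := ⟨γ t, hγσ t⟩) (b := ⟨ω, hω⟩) htC hωC hf.continuousOn
      have h0 : (0 : ℝ) ∈ Set.Icc (f ⟨γ t, hγσ t⟩) (f ⟨ω, hω⟩) := by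
        rw [hfγ, hfω]
        refine ⟨?_, zero_le_one⟩
        apply div_nonpos_of_nonpos_of_nonneg
        · nlinarith
        · positivity
      obtain ⟨⟨x, hxσ⟩, hxC, hx0⟩ := hiv h0
      have hxC' : x ∈ C := hxC
      have hxs : x ≠ γ s ∧ x ≠ γ u := by simpa using (hCσ hxC').2
      by_cases hxω : x = ω
      · subst hxω
        rw [hfω] at hx0
        exact one_ne_zero hx0
      · have hn : ‖((h ⟨x, hxσ⟩ : Metric.sphere (0 : ℂ) 1) : ℂ)‖ = 1 := by
          simp
        obtain ⟨v, hv⟩ := cay_surj (w := (h ⟨x, hxσ⟩ : ℂ) / w₀)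
          (by rw [norm_div, hn, hw₀, div_one])
          (by
            intro h1
            rw [div_eq_one_iff_eq hw0] at h1
            have h2 : h ⟨x, hxσ⟩ = h ⟨ω, hω⟩ := Subtype.ext h1
            exact hxω (congrArg Subtype.val (h.injective h2)))
        have h1 : e v = h ⟨x, hxσ⟩ := Subtype.ext (by
          show w₀ * cay v = _
          rw [hv]; field_simp)
        have h2 : γ v = x := by
          show ((h.symm (e v) : σ) : X) = x
          rw [h1, h.symm_apply_apply]
        subst h2
        rw [hfγ] at hx0
        have h3 : (v ^ 2 + 1 : ℝ) ≠ 0 := by positivity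
        rw [div_eq_zero_iff, mul_eq_zero] at hx0
        rcases hx0 with (hx0 | hx0) | hx0
        · exact hxs.1 (congrArg γ (by linarith))
        · exact hxs.2 (congrArg γ (by linarith))
        · exact h3 hx0
    have hpt := hP b (γ s) (hγσ s) (γ t) (hγσ t) (γ u) (hγσ u) ω hω hsb htb hub hωb hst' hsu'
      (hγω s) htu' (hγω t) (hγω u) hsep
    have hadm : Admissible (γ s) (γ t) (γ u) ω := by
      unfold Admissible
      have := hγω u
      have := hγω t
      tauto
    obtain ⟨k, hk, e1, e2, e3⟩ := S.moebius_equivalent ω b _ _ _ _ hadm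
    simp only [crt, hsb, htb, hub, hωb, hγω, if_false, if_true] at e1 e2 e3
    rw [e1, e2, e3] at hpt
    have : k * S.dist ω (γ s) (γ u) =
        k * (S.dist ω (γ s) (γ t) + S.dist ω (γ t) (γ u)) := by linarith
    exact mul_left_cancel₀ hk.ne' this

theorem exists_param {ω : X} {σ : Set X} (hσ : S.IsPtolemyCircle σ) (hω : ω ∈ σ) :
    ∃ c, IsParam S ω σ c := by
  obtain ⟨γ, hγc, hγi, hγr, htop, hbot, hadd⟩ := exists_gamma hσ hω
  have hγω : ∀ t, γ t ≠ ω := by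
    intro t
    have : γ t ∈ σ \ {ω} := hγr ▸ Set.mem_range_self t
    exact this.2
  let D : ℝ → ℝ → ℝ := fun s t => S.dist ω (γ s) (γ t)
  have Dself : ∀ s, D s s = 0 := fun s => S.dist_self _ _
  have Dcomm : ∀ s t, D s t = D t s := fun s t => S.dist_comm _ _ _
  have Dadd : ∀ s t u, s ≤ t → t ≤ u → D s u = D s t + D t u := by
    intro s t u hst htu
    rcases hst.eq_or_lt with rfl | hst
    · simp [Dself]
    rcases htu.eq_or_lt with rfl | htu
    · simp [Dself]
    exact hadd s t u hst htu
  have Dpos : ∀ s t, s ≠ t → 0 < D s t := fun s t h =>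
    S.dist_pos ω _ _ (hγω s) (hγω t) (hγi.ne h)
  let F : ℝ → ℝ := fun t => if 0 ≤ t then D 0 t else -D 0 t
  have hF : ∀ s t, s ≤ t → D s t = F t - F s := by
    intro s t hst
    by_cases hs : 0 ≤ s
    · have ht : 0 ≤ t := hs.trans hst
      simp only [F, hs, ht, if_true]
      linarith [Dadd 0 s t hs hst]
    · by_cases ht : 0 ≤ t
      · simp only [F, hs, ht, if_true, if_false]
        linarith [Dadd s 0 t (by linarith) ht, Dcomm s 0]
      · simp only [F, hs, ht, if_false]
        linarith [Dadd s t 0 hst (by linarith), Dcomm s 0, Dcomm t 0]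
  have hFabs : ∀ s t, D s t = |F s - F t| := by
    intro s t
    have hnn : ∀ s t, 0 ≤ D s t := by
      intro s t
      by_cases h : s = t
      · rw [h, Dself]
      · exact (Dpos s t h).le
    rcases le_total s t with h | h
    · rw [abs_sub_comm, ← hF s t h, abs_of_nonneg (hnn s t)]
    · rw [← hF t s h, abs_of_nonneg (hnn t s), Dcomm]
  have hFc : Continuous F := by
    rw [continuous_iff_continuousAt]
    intro t
    rw [Metric.continuousAt_iff']
    intro ε hε
    have hop := S.isOpen_ball ω (γ t) ε (hγω t)
    have hm : {y | y ≠ ω ∧ S.dist ω (γ t) y < ε} ∈ nhds (γ t) :=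
      hop.mem_nhds ⟨hγω t, by rw [S.dist_self]; exact hε⟩
    filter_upwards [hγc.continuousAt hm] with v hv
    rw [Real.dist_eq, ← hFabs, Dcomm]
    exact hv.2
  have hbig : ∀ l : Filter ℝ, Filter.Tendsto γ l (nhds ω) → ∀ r : ℝ, ∀ᶠ t in l, r < D 0 t := by
    intro l hl r
    have hop := S.isOpen_compl_closedBall ω (γ 0) r (hγω 0)
    have hm := hop.mem_nhds (x := ω) (Or.inr rfl)
    filter_upwards [hl hm] with v hv
    rcases hv with hv | hv
    · exact hv.2
    · exact absurd hv (hγω v)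
  have hFtop : Filter.Tendsto F Filter.atTop Filter.atTop := by
    rw [Filter.tendsto_atTop]
    intro r
    filter_upwards [hbig _ htop r, Filter.eventually_ge_atTop 0] with v hv hv0
    simp only [F, hv0, if_true]
    exact hv.le
  have hFbot : Filter.Tendsto F Filter.atBot Filter.atBot := by
    rw [Filter.tendsto_atBot]
    intro r
    filter_upwards [hbig _ hbot (-r), Filter.eventually_lt_atBot 0] with v hv hv0
    simp only [F, not_le.mpr hv0, if_false]
    linarith
  have hFs : Function.Surjective F := hFc.surjective hFtop hFbot
  have hFi : Function.Injective F := by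
    intro s t hst
    by_contra hne
    have := Dpos s t hne
    rw [hFabs, hst] at this
    simp at this
  let E : ℝ ≃ ℝ := Equiv.ofBijective F ⟨hFi, hFs⟩
  refine ⟨fun t => γ (E.symm t), ?_, ?_⟩
  · rw [← hγr]
    exact E.symm.surjective.range_comp γ
  · intro s t
    have hE : ∀ s, F (E.symm s) = s := fun s => E.apply_symm_apply s
    have := hFabs (E.symm s) (E.symm t)
    rw [hE, hE] at this
    exact this

theorem exists_param_zero {ω o : X} {σ : Set X} (hσ : S.IsPtolemyCircle σ) (hω : ω ∈ σ)
    (ho : o ∈ σ) (hoω : o ≠ ω) : ∃ c, IsParam S ω σ c ∧ c 0 = o := by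
  obtain ⟨c, hc⟩ := exists_param hσ hω
  obtain ⟨a, ha⟩ := hc.exists ho hoω
  exact ⟨_, hc.shift a, by simpa using ha⟩

theorem exists_param_pos {ω o p : X} {σ : Set X} (hσ : S.IsPtolemyCircle σ) (hω : ω ∈ σ)
    (ho : o ∈ σ) (hoω : o ≠ ω) (hp : p ∈ σ) (hpω : p ≠ ω) :
    ∃ c, IsParam S ω σ c ∧ c 0 = o ∧ c (S.dist ω o p) = p := by
  obtain ⟨c, hc, h0⟩ := exists_param_zero hσ hω ho hoω
  obtain ⟨a, ha⟩ := hc.exists hp hpω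
  have hd : S.dist ω o p = |a| := by rw [← h0, ← ha, hc.2]; simp
  rcases abs_choice a with h | h
  · exact ⟨c, hc, h0, by rw [hd, h, ha]⟩
  · exact ⟨_, hc.flip 0, by simpa using h0, by rw [hd, h]; simpa using ha⟩

/-- Two Ptolemy circles sharing three points coincide. -/
theorem line_unique (hSI : S.PropSI) {ω o p : X} {σ σ' : Set X} (hσ : S.IsPtolemyCircle σ)
    (hσ' : S.IsPtolemyCircle σ') (hω : ω ∈ σ) (hω' : ω ∈ σ') (ho : o ∈ σ) (ho' : o ∈ σ')
    (hp : p ∈ σ) (hp' : p ∈ σ') (hoω : o ≠ ω) (hpω : p ≠ ω) (hop : o ≠ p) :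
    σ \ {ω} = σ' \ {ω} := by
  obtain ⟨c, hc, h0, h1⟩ := exists_param_pos hσ hω ho hoω hp hpω
  obtain ⟨c', hc', h0', h1'⟩ := exists_param_pos hσ' hω' ho' hoω hp' hpω
  exact param_eq hSI hσ hσ' hω hω' hc hc' (h0.trans h0'.symm)
    (S.dist_pos ω o p hoω hpω hop) (h1.trans h1'.symm)

/-- Through any two distinct points there is a Ptolemy circle. -/
theorem exists_circle (hE : S.PropE) (hSI : S.PropSI) {ω o : X} (hne : o ≠ ω) :
    ∃ σ, S.IsPtolemyCircle σ ∧ ω ∈ σ ∧ o ∈ σ := by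
  have h1 : ∃ σ, S.IsPtolemyCircle σ ∧ ω ∈ σ := by
    obtain ⟨σ, hσ⟩ := hE
    by_cases h : ω ∈ σ
    · exact ⟨σ, hσ, h⟩
    obtain ⟨e⟩ := hσ.1
    let a : σ := e.symm ⟨1, by simp⟩
    have ha : (a : X) ≠ ω := fun h' => h (h' ▸ a.2)
    obtain ⟨φ, hM, -, hinv, hφ, -⟩ := hSI a ω ha _ ⟨1, one_pos, rfl⟩
    exact ⟨_, circle_image hM hinv hσ, a, a.2, hφ⟩
  obtain ⟨σ, hσ, hω⟩ := h1
  by_cases h : o ∈ σ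
  · exact ⟨σ, hσ, hω, h⟩
  obtain ⟨c, hc⟩ := exists_param hσ hω
  have hb := hc.mem 0
  have hbo : c 0 ≠ o := fun h' => h (h' ▸ hb.1)
  obtain ⟨φ, hM, -, hinv, hφ, -, hfix, -⟩ := hSI (c 0) o hbo _
    ⟨S.dist o (c 0) ω, S.dist_pos o _ _ hbo hne.symm hb.2, rfl⟩
  exact ⟨_, circle_image hM hinv hσ, ⟨ω, hω, hfix ω ⟨hne.symm, rfl⟩⟩, c 0, hb.1, hφ⟩

end

/-- if a compact Ptolemy space with properties (E) and (sI) is not Möbius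
equivalent to the extended real line, then for any two distinct points `ω, ω'` there are
two distinct Ptolemy lines in `X_ω` whose intersection is exactly `{ω'}`. -/
theorem exist_nonparallel_lines
    {X : Type*} [TopologicalSpace X] [CompactSpace X] [T2Space X]
    (S : MoebiusStructure X) (hE : S.PropE) (hSI : S.PropSI)
    (hnotline : ¬ MoebiusEquivToExtendedRealLine S) :
    ∀ ω ω' : X, ω ≠ ω' →
      ∃ ℓ ℓ' : Set X, S.IsPtolemyLine ω ℓ ∧ S.IsPtolemyLine ω ℓ' ∧
        ℓ ≠ ℓ' ∧ ℓ ∩ ℓ' = {ω'} := by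
  intro ω o hne
  obtain ⟨σ, hσ, hω, ho⟩ := exists_circle hE hSI hne.symm
  obtain ⟨c, hc, h0⟩ := exists_param_zero hσ hω ho hne.symm
  have hx : ∃ x, x ∉ σ := by
    by_contra hcon
    push Not at hcon
    exact hnotline (equiv_of_univ hc (Set.eq_univ_of_forall hcon))
  obtain ⟨x, hx⟩ := hx
  have hxω : ω ≠ x := fun h => hx (h ▸ hω)
  have hxo : o ≠ x := fun h => hx (h ▸ ho)
  have hr : 0 < S.dist ω o x := S.dist_pos ω o x hne.symm hxω.symm hxo
  obtain ⟨a, ha⟩ : ∃ a, a = c (S.dist ω o x) := ⟨_, rfl⟩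
  have haσ : a ∈ σ := ha ▸ (hc.mem _).1
  have haω : a ≠ ω := ha ▸ (hc.mem _).2
  have hax : a ≠ x := fun h => hx (h ▸ haσ)
  have hd : S.dist ω a o = S.dist ω o x := by
    rw [ha, ← h0, hc.2, sub_zero, h0, abs_of_pos hr]
  have hao : a ≠ o := by
    intro h
    rw [h, S.dist_self] at hd
    exact hr.ne hd
  obtain ⟨φ, hM, -, hinv, hφ, -, hfix, -⟩ := hSI a x hax _
    ⟨S.dist x a ω, S.dist_pos x _ _ hax hxω haω, rfl⟩
  have hφω : φ ω = ω := hfix ω ⟨hxω, rfl⟩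
  have hφo : φ o = o := by
    refine hfix o ⟨hxo, ?_⟩
    have hadm : Admissible a o ω x := by
      unfold Admissible; tauto
    obtain ⟨k, hk, e1, e2, -⟩ := S.moebius_equivalent ω x _ _ _ _ hadm
    simp only [crt, haω, hne.symm, hxω.symm, hxω, hax, hxo, if_false, if_true] at e1 e2
    rw [e1, e2, hd]
  have hσ' := circle_image hM hinv hσ
  have hω' : ω ∈ φ '' σ := ⟨ω, hω, hφω⟩
  have ho' : o ∈ φ '' σ := ⟨o, ho, hφo⟩
  have hx' : x ∈ φ '' σ := ⟨a, haσ, hφ⟩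
  have hneq : σ \ {ω} ≠ φ '' σ \ {ω} := by
    intro h
    have : x ∈ σ \ {ω} := h ▸ (⟨hx', hxω.symm⟩ : x ∈ φ '' σ \ {ω})
    exact hx this.1
  refine ⟨σ \ {ω}, φ '' σ \ {ω}, ⟨σ, hσ, hω, rfl⟩, ⟨_, hσ', hω', rfl⟩, hneq, ?_⟩
  ext p
  constructor
  · rintro ⟨⟨hp, hpω⟩, hp', -⟩
    by_contra hpo
    exact hneq (line_unique hSI hσ hσ' hω hω' ho ho' hp hp' hne.symm hpω (Ne.symm hpo))
  · rintro rfl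
    exact ⟨⟨ho, hne.symm⟩, ho', hne.symm⟩
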